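/- arXiv:1407.7160 — 5 statements merged into one kernel-verified Lean document; each statement's English description precedes it below -/
import Mathlib

section
/- Let H be a complex separable Hilbert space of positive even or infinite (countable) dimension, and let J be a conjugation on H. Then there exists a closed subspace M of H such that M is orthogonal to its image JM = {Jx : x ∈ M} and H is the orthogonal direct sum M ⊕ JM. -/
open scoped ComplexInnerProductSpace

section Conjugation

variable {H : Type*} [NormedAddCommGroup H] [InnerProductSpace ℂ H]

/-- A maximal orthonormal set of vectors fixed by the conjugation `J` is total. -/
theorem exists_orthonormal_fixed_total (J : H → H)
    (hJ_add : ∀ x y : H, J (x + y) = J x + J y)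
    (hJ_smul : ∀ (c : ℂ) (x : H), J (c • x) = (starRingEnd ℂ c) • J x)
    (hJ_invol : ∀ x : H, J (J x) = x)
    (hJ_inner : ∀ x y : H, ⟪J x, J y⟫ = ⟪y, x⟫) :
    ∃ s : Set H, Orthonormal ℂ ((↑) : s → H) ∧ (∀ x ∈ s, J x = x) ∧
      ∀ z : H, (∀ x ∈ s, ⟪x, z⟫ = 0) → z = 0 := by
  obtain ⟨s, hs⟩ := zorn_subset
    {s : Set H | Orthonormal ℂ ((↑) : s → H) ∧ ∀ x ∈ s, J x = x} (by
      intro c hc hchain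
      refine ⟨⋃₀ c, ⟨?_, ?_⟩, fun s hs => Set.subset_sUnion_of_mem hs⟩
      · exact orthonormal_sUnion_of_directed hchain.directedOn fun a ha => (hc ha).1
      · rintro x ⟨a, ha, hx⟩
        exact (hc ha).2 x hx)
  obtain ⟨hso, hsJ⟩ := hs.prop
  have fixed_eq_zero : ∀ w : H, J w = w → (∀ x ∈ s, ⟪x, w⟫ = 0) → w = 0 := by
    intro w hw hws
    by_contra hne
    set u : H := ((‖w‖⁻¹ : ℝ) : ℂ) • w with hu
    have hu_norm : ‖u‖ = 1 := by
      rw [hu, norm_smul, Complex.norm_real, norm_inv, norm_norm,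
        inv_mul_cancel₀ (norm_ne_zero_iff.mpr hne)]
    have hus : ∀ x ∈ s, ⟪x, u⟫ = 0 := fun x hx => by
      rw [hu, inner_smul_right, hws x hx, mul_zero]
    have hu_mem : u ∈ s := by
      refine hs.le_of_ge (y := insert u s) ⟨?_, ?_⟩ (Set.subset_insert u s) (Set.mem_insert u s)
      · refine ⟨?_, ?_⟩
        · rintro ⟨x, rfl | hx⟩
          · exact hu_norm
          · exact hso.1 ⟨x, hx⟩
        · rintro ⟨x, rfl | hx⟩ ⟨y, rfl | hy⟩ hxy
          · exact absurd rfl hxy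
          · exact inner_eq_zero_symm.mp (hus y hy)
          · exact hus x hx
          · exact hso.2 (i := ⟨x, hx⟩) (j := ⟨y, hy⟩) fun h =>
              hxy (Subtype.ext (Subtype.mk.inj h))
      · rintro x (rfl | hx)
        · rw [hu, hJ_smul, hw, Complex.conj_ofReal]
        · exact hsJ x hx
    have h0 : u = 0 := inner_self_eq_zero.mp (hus u hu_mem)
    rw [h0, norm_zero] at hu_norm
    exact zero_ne_one hu_norm
  refine ⟨s, hso, hsJ, fun z hz => ?_⟩
  have hJz : ∀ x ∈ s, ⟪x, J z⟫ = 0 := fun x hx => by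
    rw [← hsJ x hx, hJ_inner]
    exact inner_eq_zero_symm.mp (hz x hx)
  have hre : z + J z = 0 := by
    refine fixed_eq_zero _ ?_ fun x hx => ?_
    · rw [hJ_add, hJ_invol, add_comm]
    · rw [inner_add_right, hz x hx, hJz x hx, add_zero]
  have him : Complex.I • z + (-Complex.I) • J z = 0 := by
    refine fixed_eq_zero _ ?_ fun x hx => ?_
    · rw [hJ_add, hJ_smul, hJ_smul, hJ_invol, map_neg, Complex.conj_I, neg_neg, add_comm]
    · rw [inner_add_right, inner_smul_right, inner_smul_right, hz x hx, hJz x hx]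
      simp
  have hJz_eq : J z = -z := eq_neg_of_add_eq_zero_right hre
  rw [hJz_eq, smul_neg, neg_smul, neg_neg, ← add_smul] at him
  exact (smul_eq_zero.mp him).resolve_left (by simp [← two_mul])

/-- A total orthonormal set in a space of even or infinite dimension splits into two halves of
equal cardinality. -/
theorem Orthonormal.exists_equiv_sum_self {s : Set H} (hs : Orthonormal ℂ ((↑) : s → H))
    (htotal : ∀ z : H, (∀ x ∈ s, ⟪x, z⟫ = 0) → z = 0)
    (hdim : (∃ d : ℕ, Module.finrank ℂ H = 2 * d) ∨ ¬ FiniteDimensional ℂ H) :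
    ∃ t : Set H, Nonempty (t ⊕ t ≃ s) := by
  rcases s.finite_or_infinite with hfin | hinf
  · have : Fintype s := hfin.fintype
    have : FiniteDimensional ℂ (Submodule.span ℂ s) := FiniteDimensional.span_of_finite ℂ hfin
    have htop : Submodule.span ℂ s = ⊤ := by
      rw [← Submodule.orthogonal_eq_bot_iff, Submodule.eq_bot_iff]
      exact fun z hz => htotal z fun x hx => hz x (Submodule.subset_span hx)
    have hcard : Module.finrank ℂ H = Fintype.card s := by
      rw [← finrank_top, ← htop, finrank_span_set_eq_card hs.linearIndependent, Set.toFinset_card]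
    have hfd : FiniteDimensional ℂ H := ⟨htop ▸ Submodule.fg_span hfin⟩
    obtain ⟨d, hd⟩ := hdim.resolve_right (not_not_intro hfd)
    obtain ⟨t, hts, ht⟩ := Set.exists_subset_card_eq (s := s) (n := d) (by
      rw [← Nat.card_coe_set_eq, Nat.card_eq_fintype_card]; omega)
    have : Fintype t := (hfin.subset hts).fintype
    rw [← Nat.card_coe_set_eq, Nat.card_eq_fintype_card] at ht
    exact ⟨t, ⟨Fintype.equivOfCardEq (by rw [Fintype.card_sum]; omega)⟩⟩
  · have : Infinite s := hinf.to_subtype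
    refine ⟨s, Cardinal.eq.mp ?_⟩
    rw [← Cardinal.add_def]
    exact Cardinal.add_eq_self (Cardinal.aleph0_le_mk s)

/-- If `M ⊥ J M` and the orthogonal complement of `M + J M` vanishes, then `M ⊕ J M` is the whole
space. -/
theorem exists_eq_add_conj_of_orthogonal (J : H → H)
    (hJ_add : ∀ x y : H, J (x + y) = J x + J y)
    (hJ_invol : ∀ x : H, J (J x) = x)
    (M : Submodule ℂ H) [M.HasOrthogonalProjection]
    (hM : ∀ x ∈ M, ∀ y ∈ M, ⟪x, J y⟫ = 0)
    (htotal : ∀ z ∈ Mᗮ, J z ∈ Mᗮ → z = 0) (z : H) :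
    ∃ x ∈ M, ∃ y ∈ M, z = x + J y := by
  obtain ⟨x, hx, w, hw, rfl⟩ := M.exists_add_mem_mem_orthogonal z
  obtain ⟨y, hy, r, hr, hyr⟩ := M.exists_add_mem_mem_orthogonal (J w)
  have hw_eq : w = J y + J r := by rw [← hJ_add, ← hyr, hJ_invol]
  have hJy : J y ∈ Mᗮ := fun a ha => hM a ha y hy
  have hJr : J r ∈ Mᗮ := by
    rw [eq_sub_of_add_eq' hw_eq.symm]
    exact Mᗮ.sub_mem hw hJy
  rw [htotal r hr hJr, add_zero] at hyr
  exact ⟨x, hx, y, hy, by rw [← hyr, hJ_invol]⟩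

end Conjugation

/-- **Lemma 2.1.** If `H` is a complex separable Hilbert space of positive even
or infinite dimension and `J` is a conjugation on `H`, then there is a closed subspace `M`
of `H` with `M ⊥ JM` and `M ⊕ JM = H` (every element of `H` is `x + J y` with `x, y ∈ M`). -/
theorem exists_subspace_oplus_conj_image_eq_top
    {H : Type*} [NormedAddCommGroup H] [InnerProductSpace ℂ H] [CompleteSpace H]
    [TopologicalSpace.SeparableSpace H]
    (J : H → H)
    (hJ_add : ∀ x y : H, J (x + y) = J x + J y)
    (hJ_smul : ∀ (c : ℂ) (x : H), J (c • x) = (starRingEnd ℂ c) • J x)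
    (hJ_invol : ∀ x : H, J (J x) = x)
    (hJ_inner : ∀ x y : H, ⟪J x, J y⟫ = ⟪y, x⟫)
    (hdim : (∃ d : ℕ, 0 < d ∧ Module.finrank ℂ H = 2 * d) ∨ ¬ FiniteDimensional ℂ H) :
    ∃ M : Submodule ℂ H, IsClosed (M : Set H) ∧
      (∀ x ∈ M, ∀ y ∈ M, ⟪x, J y⟫ = 0) ∧
      (∀ z : H, ∃ x ∈ M, ∃ y ∈ M, z = x + J y) := by
  obtain ⟨s, hso, hsJ, htotal⟩ :=
    exists_orthonormal_fixed_total J hJ_add hJ_smul hJ_invol hJ_inner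
  obtain ⟨t, ⟨φ⟩⟩ := hso.exists_equiv_sum_self htotal
    (hdim.imp_left fun ⟨d, _, hd⟩ => ⟨d, hd⟩)
  set e : t ⊕ t → H := fun i => φ i
  have he : Orthonormal ℂ e := hso.comp φ φ.injective
  have heJ : ∀ i, J (e i) = e i := fun i => hsJ _ (φ i).2
  classical
  have he_inner := orthonormal_iff_ite.mp he
  set f : t → H := fun k => e (.inl k) + Complex.I • e (.inr k) with hf
  have hJf : ∀ k, J (f k) = e (.inl k) - Complex.I • e (.inr k) := fun k => by
    rw [hf, hJ_add, hJ_smul, heJ, heJ, Complex.conj_I, neg_smul, ← sub_eq_add_neg]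
  have inner_J_comm : ∀ x y : H, ⟪x, J y⟫ = ⟪y, J x⟫ := fun x y => by
    rw [← hJ_inner, hJ_invol]
  have hff : ∀ k l, ⟪f k, J (f l)⟫ = 0 := fun k l => by
    rw [hJf]
    simp only [hf, inner_add_left, inner_sub_right, inner_smul_left, inner_smul_right, he_inner]
    by_cases hkl : k = l <;> simp [hkl]
  set M : Submodule ℂ H := (Submodule.span ℂ (Set.range f)).topologicalClosure
  have hM_closed : IsClosed (M : Set H) := Submodule.isClosed_topologicalClosure _
  have hfM : ∀ k, f k ∈ M := fun k =>
    Submodule.le_topologicalClosure _ (Submodule.subset_span ⟨k, rfl⟩)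
  have mem_orthogonal : ∀ z : H, (∀ k, ⟪f k, z⟫ = 0) → ∀ x ∈ M, ⟪x, z⟫ = 0 := fun z hz => by
    have hle : M ≤ (ℂ ∙ z)ᗮ := by
      refine Submodule.topologicalClosure_minimal _ (Submodule.span_le.mpr ?_)
        (Submodule.isClosed_orthogonal _)
      rintro _ ⟨k, rfl⟩
      exact Submodule.mem_orthogonal_singleton_iff_inner_left.mpr (hz k)
    exact fun x hx => Submodule.mem_orthogonal_singleton_iff_inner_left.mp (hle hx)
  have hM : ∀ x ∈ M, ∀ y ∈ M, ⟪x, J y⟫ = 0 := fun x hx y hy =>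
    mem_orthogonal (J y) (fun k => by
      rw [inner_J_comm]
      exact mem_orthogonal (J (f k)) (fun l => hff l k) y hy) x hx
  have : CompleteSpace M := hM_closed.completeSpace_coe
  refine ⟨M, hM_closed, hM, exists_eq_add_conj_of_orthogonal J hJ_add hJ_invol M hM ?_⟩
  intro z hz hJz
  have hpair : ∀ k, ⟪e (.inl k), z⟫ = 0 ∧ ⟪e (.inr k), z⟫ = 0 := fun k => by
    have h₁ : ⟪f k, z⟫ = 0 := hz _ (hfM k)
    have h₂ : ⟪J (f k), z⟫ = 0 := by
      rw [← hJ_invol z, hJ_inner]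
      exact inner_eq_zero_symm.mp (hJz _ (hfM k))
    rw [hJf] at h₂
    simp only [hf, inner_add_left, inner_sub_left, inner_smul_left, Complex.conj_I] at h₁ h₂
    constructor
    · linear_combination (h₁ + h₂) / 2
    · linear_combination Complex.I / 2 * (h₁ - h₂) + ⟪e (.inr k), z⟫ * Complex.I_sq
  refine htotal z fun x hx => ?_
  obtain ⟨i, hi⟩ := φ.surjective ⟨x, hx⟩
  have hix : e i = x := congrArg Subtype.val hi
  rw [← hix]
  rcases i with k | k
  exacts [(hpair k).1, (hpair k).2]
end

section
/- Let H be a complex separable Hilbert space, J a conjugation on H, and A a densely defined J-skew-symmetric linear operator in H. Then there exist a complex separable Hilbert space H̃, an isometric linear embedding ι : H → H̃, a conjugation J̃ on H̃ with J̃(ι(x)) = ι(Jx) for all x ∈ H, and a densely defined linear operator B in H̃ such that B extends A (i.e., ι(D(A)) ⊆ D(B) and B(ι(x)) = ι(Ax) for x ∈ D(A)) and B is J̃-skew-self-adjoint: J̃BJ̃ = −B*. -/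
open scoped ComplexInnerProductSpace

/-- The data of a `J̃`-skew-self-adjoint extension of a `J`-skew-symmetric operator `A`
in a possibly larger complex separable Hilbert space: a complex separable Hilbert space
`carrier`, an isometric linear embedding `ι : H → carrier`, a conjugation `Jt` on `carrier`
extending `J` (via `ι`), and a densely defined operator `B` extending `A` (via `ι`) with
`J̃ B J̃ = -B*` (expressed here by the equality of the graph of `B*` with the graph of
`-J̃ B J̃`, which encodes `D(B*) = J̃(D(B))` and `B* u = -J̃ B J̃ u`). -/
structure SkewSelfAdjointConjExtension
    {H : Type*} [NormedAddCommGroup H] [InnerProductSpace ℂ H] [CompleteSpace H]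
    (J : H → H) (A : H →ₗ.[ℂ] H) where
  carrier : Type
  [ng : NormedAddCommGroup carrier]
  [ip : InnerProductSpace ℂ carrier]
  [cs : CompleteSpace carrier]
  [sep : TopologicalSpace.SeparableSpace carrier]
  ι : H →ₗ[ℂ] carrier
  ι_inner : ∀ x y : H, ⟪ι x, ι y⟫ = ⟪x, y⟫
  Jt : carrier → carrier
  Jt_add : ∀ x y : carrier, Jt (x + y) = Jt x + Jt y
  Jt_smul : ∀ (c : ℂ) (x : carrier), Jt (c • x) = (starRingEnd ℂ c) • Jt x
  Jt_invol : ∀ x : carrier, Jt (Jt x) = x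
  Jt_inner : ∀ x y : carrier, ⟪Jt x, Jt y⟫ = ⟪y, x⟫
  Jt_extends : ∀ x : H, Jt (ι x) = ι (J x)
  B : carrier →ₗ.[ℂ] carrier
  B_dense : Dense (B.domain : Set carrier)
  B_extends : ∀ x : A.domain, ∃ h : ι x ∈ B.domain, B ⟨ι x, h⟩ = ι (A x)
  B_skew_selfadjoint : ∀ u v : carrier, (u, v) ∈ B.adjoint.graph ↔
    ∃ h : Jt u ∈ B.domain, v = -Jt (B ⟨Jt u, h⟩)

section SymmetricForm

variable {V : Type*} [AddCommGroup V] [Module ℂ V]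

open LinearMap (BilinForm)

/-- For a subspace `S`, the pairs `(p, q)` in `Sᗮ × Sᗮ` with `q - i p ∈ Sᗮᗮ`. When `S` is isotropic
for a symmetric form `ω`, this is a Lagrangian subspace for `ω ⊕ ω`. -/
def doubledLagrangian (ω : BilinForm ℂ V) (S : Submodule ℂ V) : Submodule ℂ (V × V) :=
  ((ω.orthogonal S).prod (ω.orthogonal S)) ⊓
    (ω.orthogonal (ω.orthogonal S)).comap
      (LinearMap.snd ℂ V V - Complex.I • LinearMap.fst ℂ V V)

theorem mem_doubledLagrangian {ω : BilinForm ℂ V} {S : Submodule ℂ V} {w : V × V} :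
    w ∈ doubledLagrangian ω S ↔ (w.1 ∈ ω.orthogonal S ∧ w.2 ∈ ω.orthogonal S) ∧
      w.2 - Complex.I • w.1 ∈ ω.orthogonal (ω.orthogonal S) :=
  Iff.rfl

theorem bilinForm_le_orthogonal_orthogonal {ω : BilinForm ℂ V} (hω : ∀ x y, ω x y = ω y x)
    (S : Submodule ℂ V) : S ≤ ω.orthogonal (ω.orthogonal S) :=
  BilinForm.le_orthogonal_orthogonal fun x y h => (hω y x).trans h

theorem prod_mem_doubledLagrangian {ω : BilinForm ℂ V} (hω : ∀ x y, ω x y = ω y x)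
    {S : Submodule ℂ V} (hS : S ≤ ω.orthogonal S) {w : V × V} (h₁ : w.1 ∈ S) (h₂ : w.2 ∈ S) :
    w ∈ doubledLagrangian ω S :=
  ⟨⟨hS h₁, hS h₂⟩, bilinForm_le_orthogonal_orthogonal hω S
    (S.sub_mem h₂ (S.smul_mem Complex.I h₁))⟩

theorem mem_doubledLagrangian_iff_forall {ω : BilinForm ℂ V} (hω : ∀ x y, ω x y = ω y x)
    {S : Submodule ℂ V} (hS : S ≤ ω.orthogonal S) (w : V × V) :
    w ∈ doubledLagrangian ω S ↔
      ∀ p ∈ doubledLagrangian ω S, ω p.1 w.1 + ω p.2 w.2 = 0 := by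
  have hI : Complex.I * Complex.I = -1 := Complex.I_mul_I
  constructor
  · rintro ⟨⟨hw₁, hw₂⟩, hw⟩ p ⟨⟨hp₁, hp₂⟩, hp⟩
    have h₁ : ω p.1 (w.2 - Complex.I • w.1) = 0 := hw p.1 hp₁
    have h₂ : ω w.2 (p.2 - Complex.I • p.1) = 0 := hp w.2 hw₂
    simp only [map_sub, map_smul, smul_eq_mul] at h₁ h₂
    rw [hω w.2, hω w.2] at h₂
    linear_combination h₂ + Complex.I * h₁ + ω p.1 w.1 * hI
  · intro h
    have hw₁ : w.1 ∈ ω.orthogonal S := fun s hs => by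
      simpa using h (s, 0) (prod_mem_doubledLagrangian hω hS hs S.zero_mem)
    have hw₂ : w.2 ∈ ω.orthogonal S := fun s hs => by
      simpa using h (0, s) (prod_mem_doubledLagrangian hω hS S.zero_mem hs)
    refine ⟨⟨hw₁, hw₂⟩, fun p hp => ?_⟩
    have hmem : (p, Complex.I • p) ∈ doubledLagrangian ω S :=
      ⟨⟨hp, Submodule.smul_mem _ _ hp⟩, by simp⟩
    have key := h _ hmem
    simp only [map_smul, LinearMap.smul_apply, smul_eq_mul] at key
    change ω p (w.2 - Complex.I • w.1) = 0
    simp only [map_sub, map_smul, smul_eq_mul]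
    linear_combination (-Complex.I) * key + ω p w.2 * hI

end SymmetricForm

section Conjugation

variable {E : Type*} [NormedAddCommGroup E] [InnerProductSpace ℂ E]

/-- The bilinear form `((x, a), (y, b)) ↦ ⟪J x, b⟫ + ⟪J a, y⟫` on `E × E`. -/
noncomputable def conjGraphForm (J : E →ₗ⋆[ℂ] E) : LinearMap.BilinForm ℂ (E × E) :=
  LinearMap.mk₂ ℂ (fun p q => ⟪J p.1, q.2⟫ + ⟪J p.2, q.1⟫)
    (fun p p' q => by simp only [Prod.fst_add, Prod.snd_add, map_add, inner_add_left]; ring)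
    (fun c p q => by simp; ring)
    (fun p q q' => by simp only [Prod.fst_add, Prod.snd_add, inner_add_right]; ring)
    (fun c p q => by simp [mul_add])

theorem conjGraphForm_apply (J : E →ₗ⋆[ℂ] E) (p q : E × E) :
    conjGraphForm J p q = ⟪J p.1, q.2⟫ + ⟪J p.2, q.1⟫ :=
  rfl

theorem conjGraphForm_symm {J : E →ₗ⋆[ℂ] E} (hJ : ∀ x, J (J x) = x)
    (hJ' : ∀ x y, ⟪J x, J y⟫ = ⟪y, x⟫) (p q : E × E) :
    conjGraphForm J p q = conjGraphForm J q p := by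
  have h : ∀ x y, ⟪J x, y⟫ = ⟪J y, x⟫ := fun x y => by simpa [hJ] using hJ' x (J y)
  rw [conjGraphForm_apply, conjGraphForm_apply, h p.1, h p.2, add_comm]

/-- A Lagrangian subspace with dense first projection is the graph of a densely defined
`J`-skew-self-adjoint operator. -/
theorem exists_skewSelfAdjoint_of_lagrangian [CompleteSpace E] {J : E →ₗ⋆[ℂ] E}
    (hJ : ∀ x, J (J x) = x) (hJ' : ∀ x y, ⟪J x, J y⟫ = ⟪y, x⟫) (L : Submodule ℂ (E × E))
    (hL : ∀ w, w ∈ L ↔ ∀ p ∈ L, conjGraphForm J p w = 0)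
    (hd : Dense (Prod.fst '' (L : Set (E × E)))) :
    ∃ B : E →ₗ.[ℂ] E, B.graph = L ∧ Dense (B.domain : Set E) ∧
      ∀ u v, (u, v) ∈ B.adjoint.graph ↔ ∃ h : J u ∈ B.domain, v = -J (B ⟨J u, h⟩) := by
  have hgraph : L.toLinearPMap.graph = L := by
    refine Submodule.toLinearPMap_graph_eq _ fun x hx hx0 => ?_
    have h0 : J x.2 = 0 := hd.eq_zero_of_inner_left ℂ <| by
      rintro _ ⟨p, hp, rfl⟩
      have := (hL p).1 hp x hx
      simpa [conjGraphForm_apply, hx0] using this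
    rw [← hJ x.2, h0, map_zero]
  have hdense : Dense (L.toLinearPMap.domain : Set E) := by
    rw [Submodule.toLinearPMap_domain]
    exact hd
  refine ⟨L.toLinearPMap, hgraph, hdense, fun u v => ?_⟩
  have hmem : (∃ h : J u ∈ L.toLinearPMap.domain, v = -J (L.toLinearPMap ⟨J u, h⟩)) ↔
      (J u, -J v) ∈ L := by
    conv_rhs => rw [← hgraph, LinearPMap.mem_graph_iff]
    constructor
    · rintro ⟨h, rfl⟩
      exact ⟨⟨J u, h⟩, rfl, by simp [hJ]⟩
    · rintro ⟨⟨y, hy⟩, rfl, h⟩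
      exact ⟨hy, by dsimp only at h; rw [h]; simp [hJ]⟩
  rw [hmem, hL, LinearPMap.adjoint_graph_eq_graph_adjoint hdense, Submodule.mem_adjoint_iff,
    hgraph, Prod.forall]
  refine forall_congr' fun a => forall_congr' fun b => imp_congr_right fun _ => ?_
  rw [conjGraphForm_apply, inner_neg_right, hJ', hJ', ← inner_conj_symm b, ← inner_conj_symm a,
    ← map_sub, map_eq_zero, neg_add_eq_sub]

/-- The conjugation acting as `J` in both coordinates of `E × E`. -/
noncomputable def prodConj (J : E →ₗ⋆[ℂ] E) : WithLp 2 (E × E) →ₗ⋆[ℂ] WithLp 2 (E × E) where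
  toFun z := WithLp.toLp 2 (J z.fst, J z.snd)
  map_add' _ _ := WithLp.ofLp_injective 2 <| Prod.ext (map_add J _ _) (map_add J _ _)
  map_smul' c _ := WithLp.ofLp_injective 2 <| Prod.ext (map_smulₛₗ J c _) (map_smulₛₗ J c _)

theorem prodConj_apply (J : E →ₗ⋆[ℂ] E) (z : WithLp 2 (E × E)) :
    prodConj J z = WithLp.toLp 2 (J z.fst, J z.snd) :=
  rfl

theorem prodConj_prodConj {J : E →ₗ⋆[ℂ] E} (hJ : ∀ x, J (J x) = x) (z : WithLp 2 (E × E)) :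
    prodConj J (prodConj J z) = z :=
  WithLp.ofLp_injective 2 <| Prod.ext (hJ _) (hJ _)

theorem inner_prodConj_prodConj {J : E →ₗ⋆[ℂ] E} (hJ : ∀ x y, ⟪J x, J y⟫ = ⟪y, x⟫)
    (x y : WithLp 2 (E × E)) : ⟪prodConj J x, prodConj J y⟫ = ⟪y, x⟫ := by
  simp [prodConj_apply, WithLp.prod_inner_apply, hJ]

/-- Regroup a pair of elements of `E × E` from (positions, values) to two (position, value)
pairs. -/
def regroupProd (E : Type*) [NormedAddCommGroup E] [InnerProductSpace ℂ E] :
    WithLp 2 (E × E) × WithLp 2 (E × E) →ₗ[ℂ] (E × E) × (E × E) where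
  toFun w := ((w.1.fst, w.2.fst), (w.1.snd, w.2.snd))
  map_add' _ _ := rfl
  map_smul' _ _ := rfl

theorem regroupProd_apply (w : WithLp 2 (E × E) × WithLp 2 (E × E)) :
    regroupProd E w = ((w.1.fst, w.2.fst), (w.1.snd, w.2.snd)) :=
  rfl

theorem conjGraphForm_prodConj (J : E →ₗ⋆[ℂ] E) (p w : WithLp 2 (E × E) × WithLp 2 (E × E)) :
    conjGraphForm (prodConj J) p w =
      conjGraphForm J (regroupProd E p).1 (regroupProd E w).1 +
        conjGraphForm J (regroupProd E p).2 (regroupProd E w).2 := by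
  simp only [conjGraphForm_apply, prodConj_apply, regroupProd_apply, WithLp.prod_inner_apply]
  simp only [WithLp.ofLp_fst, WithLp.ofLp_snd]
  ring

/-- An isotropic subspace with dense first projection is contained in the graph of a
skew-self-adjoint operator on the doubled space. -/
theorem exists_skewSelfAdjoint_prod [CompleteSpace E] {J : E →ₗ⋆[ℂ] E}
    (hJ : ∀ x, J (J x) = x) (hJ' : ∀ x y, ⟪J x, J y⟫ = ⟪y, x⟫) (S : Submodule ℂ (E × E))
    (hS : ∀ p ∈ S, ∀ q ∈ S, conjGraphForm J p q = 0)
    (hd : Dense (Prod.fst '' (S : Set (E × E)))) :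
    ∃ B : WithLp 2 (E × E) →ₗ.[ℂ] WithLp 2 (E × E),
      (∀ p ∈ S, (WithLp.toLp 2 (p.1, 0), WithLp.toLp 2 (p.2, 0)) ∈ B.graph) ∧
      Dense (B.domain : Set (WithLp 2 (E × E))) ∧
      ∀ u v, (u, v) ∈ B.adjoint.graph ↔
        ∃ h : prodConj J u ∈ B.domain, v = -prodConj J (B ⟨prodConj J u, h⟩) := by
  have hω := conjGraphForm_symm hJ hJ'
  have hS' : S ≤ (conjGraphForm J).orthogonal S := fun q hq p hp => hS p hp q hq
  obtain ⟨B, hB, hBd, hBs⟩ := exists_skewSelfAdjoint_of_lagrangian (J := prodConj J)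
    (prodConj_prodConj hJ) (inner_prodConj_prodConj hJ')
    ((doubledLagrangian (conjGraphForm J) S).comap (regroupProd E))
    (fun w => by
      simp only [Submodule.mem_comap, conjGraphForm_prodConj]
      rw [mem_doubledLagrangian_iff_forall hω hS']
      refine ⟨fun h p hp => h _ hp, fun h p hp => ?_⟩
      exact h (WithLp.toLp 2 (p.1.1, p.2.1), WithLp.toLp 2 (p.1.2, p.2.2)) hp)
    (by
      have hdd := (hd.prod hd).preimage
        (WithLp.homeomorphProd 2 E E).isOpenMap
      refine hdd.mono ?_
      rintro z ⟨⟨p, hp, hpz⟩, ⟨q, hq, hqz⟩⟩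
      refine ⟨(z, WithLp.toLp 2 (p.2, q.2)), ?_, rfl⟩
      refine prod_mem_doubledLagrangian hω hS' ?_ ?_
      · have : (z.fst, p.2) = p := Prod.ext hpz.symm rfl
        simpa [regroupProd_apply, this] using hp
      · have : (z.snd, q.2) = q := Prod.ext hqz.symm rfl
        simpa [regroupProd_apply, this] using hq)
  refine ⟨B, fun p hp => ?_, hBd, hBs⟩
  rw [hB]
  exact prod_mem_doubledLagrangian hω hS' hp S.zero_mem

end Conjugation

theorem Orthonormal.countable_of_separableSpace {𝕜 H ι : Type*} [RCLike 𝕜] [NormedAddCommGroup H]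
    [InnerProductSpace 𝕜 H] [TopologicalSpace.SeparableSpace H] {v : ι → H}
    (hv : Orthonormal 𝕜 v) : Countable ι := by
  refine Pairwise.countable_of_isOpen_disjoint (s := fun i => Metric.ball (v i) (1 / 2))
    (fun i j hij => Metric.ball_disjoint_ball ?_) (fun _ => Metric.isOpen_ball)
    (fun i => Metric.nonempty_ball.2 (by norm_num))
  have h := norm_sub_sq (𝕜 := 𝕜) (v i) (v j)
  rw [hv.inner_eq_zero hij, hv.norm_eq_one, hv.norm_eq_one, map_zero] at h
  rw [dist_eq_norm]
  nlinarith [norm_nonneg (v i - v j)]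

/-- A separable Hilbert space is isometric to an `ℓ²` space whose index type lies in `Type`. -/
theorem exists_linearIsometryEquiv_lp (𝕜 H : Type*) [RCLike 𝕜] [NormedAddCommGroup H]
    [InnerProductSpace 𝕜 H] [CompleteSpace H] [TopologicalSpace.SeparableSpace H] :
    ∃ ι : Type, Nonempty (H ≃ₗᵢ[𝕜] lp (fun _ : ι => 𝕜) 2) := by
  obtain ⟨w, b, -⟩ := exists_hilbertBasis 𝕜 H
  have : Countable w := b.orthonormal.countable_of_separableSpace
  let f := (equivShrink.{0} w).symm
  refine ⟨Shrink.{0} w, ⟨(HilbertBasis.mk (b.orthonormal.comp f f.injective) ?_).repr⟩⟩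
  rw [f.surjective.range_comp b]
  exact b.dense_span.ge

/-- **Theorem 2.1, skew-symmetric case.** Every densely defined
`J`-skew-symmetric operator `A` in a complex separable Hilbert space `H` admits a
`J̃`-skew-self-adjoint extension `B` in a complex separable Hilbert space `H̃ ⊇ H`,
where `J̃` is a conjugation on `H̃` extending `J`. -/
theorem exists_skew_selfadjoint_extension
    {H : Type*} [NormedAddCommGroup H] [InnerProductSpace ℂ H] [CompleteSpace H]
    [TopologicalSpace.SeparableSpace H]
    (J : H → H)
    (hJ_add : ∀ x y : H, J (x + y) = J x + J y)
    (hJ_smul : ∀ (c : ℂ) (x : H), J (c • x) = (starRingEnd ℂ c) • J x)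
    (hJ_invol : ∀ x : H, J (J x) = x)
    (hJ_inner : ∀ x y : H, ⟪J x, J y⟫ = ⟪y, x⟫)
    (A : H →ₗ.[ℂ] H) (hA_dense : Dense (A.domain : Set H))
    (hA_skew : ∀ x y : A.domain, ⟪A x, J y⟫ = -⟪(x : H), J (A y)⟫) :
    Nonempty (SkewSelfAdjointConjExtension J A) := by
  obtain ⟨κ, ⟨e⟩⟩ := exists_linearIsometryEquiv_lp ℂ H
  let E := lp (fun _ : κ => ℂ) 2
  have : TopologicalSpace.SeparableSpace E :=
    e.surjective.denseRange.separableSpace e.continuous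
  have : TopologicalSpace.SeparableSpace (WithLp 2 (E × E)) :=
    (WithLp.homeomorphProd 2 E E).symm.surjective.denseRange.separableSpace
      (WithLp.homeomorphProd 2 E E).symm.continuous
  let J' : E →ₗ⋆[ℂ] E :=
    { toFun := fun x => e (J (e.symm x))
      map_add' := fun x y => by simp [hJ_add]
      map_smul' := fun c x => by simp [hJ_smul] }
  have hJ'_apply (x : E) : J' x = e (J (e.symm x)) := rfl
  have hJ'_invol (x : E) : J' (J' x) = x := by simp [hJ'_apply, hJ_invol]
  have hJ'_inner (x y : E) : ⟪J' x, J' y⟫ = ⟪y, x⟫ := by simp [hJ'_apply, hJ_inner]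
  let S : Submodule ℂ (E × E) :=
    A.graph.map (e.toLinearEquiv.toLinearMap.prodMap e.toLinearEquiv.toLinearMap)
  have hmem (x : A.domain) : (e x, e (A x)) ∈ S := ⟨(x, A x), A.mem_graph x, rfl⟩
  obtain ⟨B, hBext, hBd, hBs⟩ := exists_skewSelfAdjoint_prod hJ'_invol hJ'_inner S
    (by
      rintro _ ⟨p, hp, rfl⟩ _ ⟨q, hq, rfl⟩
      obtain ⟨x, hx, hx'⟩ := A.mem_graph_iff.1 hp
      obtain ⟨y, hy, hy'⟩ := A.mem_graph_iff.1 hq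
      have h := hA_skew y x
      rw [hx, hx', hy, hy', ← inner_conj_symm, ← inner_conj_symm q.1, ← map_neg] at h
      have h := (starRingEnd ℂ).injective h
      simp [conjGraphForm_apply, hJ'_apply, h])
    (by
      refine (e.surjective.denseRange.dense_image e.continuous hA_dense).mono ?_
      rintro _ ⟨x, hx, rfl⟩
      exact ⟨_, hmem ⟨x, hx⟩, rfl⟩)
  exact ⟨{
    carrier := WithLp 2 (E × E)
    ι := (WithLp.linearEquiv 2 ℂ (E × E)).symm.toLinearMap ∘ₗ LinearMap.inl ℂ E E ∘ₗ
      e.toLinearEquiv.toLinearMap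
    ι_inner := fun x y => by simp [WithLp.prod_inner_apply]
    Jt := prodConj J'
    Jt_add := map_add _
    Jt_smul := fun c x => map_smulₛₗ _ c x
    Jt_invol := prodConj_prodConj hJ'_invol
    Jt_inner := inner_prodConj_prodConj hJ'_inner
    Jt_extends := fun x => WithLp.ofLp_injective 2 <|
      Prod.ext (by simp [prodConj_apply, hJ'_apply]) (map_zero J')
    B := B
    B_dense := hBd
    B_extends := fun x => by
      obtain ⟨⟨y, hy⟩, rfl, h⟩ := B.mem_graph_iff.1 (hBext _ (hmem x))
      exact ⟨hy, h⟩
    B_skew_selfadjoint := hBs }⟩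
end

section
/- Let H be a complex Hilbert space, J a conjugation on H, and B a densely defined linear operator in H. Let R be the conjugation on H ⊕ H given by R{x,y} = {Jy, Jx}, and let G_B be the graph of B. If H ⊕ H is the orthogonal direct sum of G_B and RG_B, then B is J-skew-self-adjoint: JBJ = −B*, i.e., D(B*) = J(D(B)) and B*u = −J B J u for all u ∈ J(D(B)). -/
open scoped ComplexInnerProductSpace

/-- Membership in the graph of the adjoint of a densely defined operator. -/
theorem LinearPMap.mem_graph_adjoint_iff
    {H : Type*} [NormedAddCommGroup H] [InnerProductSpace ℂ H] [CompleteSpace H]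
    (B : H →ₗ.[ℂ] H) (hB : Dense (B.domain : Set H)) (u v : H) :
    (u, v) ∈ B.adjoint.graph ↔ ∀ x : B.domain, ⟪v, (x : H)⟫ = ⟪u, B x⟫ := by
  constructor
  · rw [LinearPMap.mem_graph_iff]
    rintro ⟨y, hy, hv⟩ x
    dsimp only at hy hv
    rw [← hy, ← hv]
    exact B.adjoint_isFormalAdjoint hB y x
  · intro h
    have hu : u ∈ B.adjoint.domain := B.mem_adjoint_domain_of_exists u ⟨v, h⟩
    rw [LinearPMap.mem_graph_iff]
    exact ⟨⟨u, hu⟩, rfl, LinearPMap.adjoint_apply_eq hB ⟨u, hu⟩ h⟩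

/-- Let `B` be densely defined and `R{x,y} = {Jy, Jx}` the conjugation on
`H ⊕ H`.  If `H ⊕ H` is the orthogonal direct sum of `G_B` and `R G_B`, then `B` is
`J`-skew-self-adjoint: `D(B*) = J(D(B))` and `B* u = -J B J u` for all `u ∈ J(D(B))`. -/
theorem jSkewSelfAdjoint_of_graph_Rgraph_decomposition
    {H : Type*} [NormedAddCommGroup H] [InnerProductSpace ℂ H] [CompleteSpace H]
    (J : H → H)
    (hJ_add : ∀ x y : H, J (x + y) = J x + J y)
    (hJ_smul : ∀ (c : ℂ) (x : H), J (c • x) = (starRingEnd ℂ c) • J x)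
    (hJ_invol : ∀ x : H, J (J x) = x)
    (hJ_inner : ∀ x y : H, ⟪J x, J y⟫ = ⟪y, x⟫)
    (B : H →ₗ.[ℂ] H) (hB_dense : Dense (B.domain : Set H))
    (h_orth : ∀ x y : B.domain, ⟪(x : H), J (B y)⟫ + ⟪B x, J (y : H)⟫ = 0)
    (h_sum : ∀ p : H × H, ∃ x y : B.domain,
      p = ((x : H) + J (B y), B x + J (y : H))) :
    ∀ u v : H, (u, v) ∈ B.adjoint.graph ↔
      ∃ h : J u ∈ B.domain, v = -J (B ⟨J u, h⟩) := by
  intro u v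
  have hJ_neg : ∀ x : H, J (-x) = -J x := fun x => by simpa using hJ_smul (-1) x
  rw [B.mem_graph_adjoint_iff hB_dense]
  constructor
  · intro huv
    obtain ⟨x, y, hxy⟩ := h_sum (v, -u)
    obtain ⟨hv, hu⟩ := Prod.mk.inj hxy
    have hzero : ⟪(x : H), (x : H)⟫ + ⟪B x, B x⟫ = 0 := by
      have hadj := huv x
      have horth := congrArg (starRingEnd ℂ) (h_orth x y)
      rw [hv, ← neg_neg u, hu] at hadj
      simp only [map_add, inner_conj_symm, map_zero, inner_neg_left, inner_add_left]
        at hadj horth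
      linear_combination hadj - horth
    have hnorm : ‖(x : H)‖ ^ 2 + ‖B x‖ ^ 2 = 0 := by
      rw [inner_self_eq_norm_sq_to_K, inner_self_eq_norm_sq_to_K] at hzero
      exact Complex.ofReal_injective (by push_cast; exact hzero)
    have hx : (x : H) = 0 := norm_eq_zero.mp (by nlinarith [sq_nonneg ‖B x‖])
    have hBx : B x = 0 := norm_eq_zero.mp (by nlinarith [sq_nonneg ‖(x : H)‖])
    rw [hx, zero_add] at hv
    rw [hBx, zero_add] at hu
    have hJu : J u = ((-y : B.domain) : H) := by
      rw [← neg_neg u, hu, hJ_neg, hJ_invol, Submodule.coe_neg]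
    have hmem : J u ∈ B.domain := hJu ▸ (-y).2
    refine ⟨hmem, ?_⟩
    have hsub : (⟨J u, hmem⟩ : B.domain) = -y := Subtype.ext hJu
    rw [hsub, B.map_neg, hJ_neg, neg_neg, hv]
  · rintro ⟨h, rfl⟩ x
    have horth := congrArg (starRingEnd ℂ) (h_orth x ⟨J u, h⟩)
    simp only [map_add, inner_conj_symm, map_zero, hJ_invol] at horth
    rw [inner_neg_left]
    linear_combination -horth
end

section
/- Let H be a complex Hilbert space, J a conjugation on H, and A a J-isometric linear operator in H with dense domain and dense range. Then A is closable, and its closure Ā is again J-isometric: [Āx, Āy]_J = [x, y]_J for all x, y ∈ D(Ā). -/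
open scoped ComplexInnerProductSpace

/-- An additive map that reverses the inner product is continuous. -/
lemma continuous_of_add_of_inner_swap
    {H : Type*} [NormedAddCommGroup H] [InnerProductSpace ℂ H]
    (J : H → H) (hJ_add : ∀ x y : H, J (x + y) = J x + J y)
    (hJ_inner : ∀ x y : H, ⟪J x, J y⟫ = ⟪y, x⟫) : Continuous J := by
  have hnorm : ∀ x, ‖J x‖ = ‖x‖ := fun x ↦ by
    rw [@norm_eq_sqrt_re_inner ℂ, @norm_eq_sqrt_re_inner ℂ, hJ_inner]
  exact (AddMonoidHomClass.isometry_of_norm (AddMonoidHom.mk' J hJ_add) hnorm).continuous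

/-- The identity `[u, v]_J = [x, y]_J` for pairs `(x, u)`, `(y, v)` passes from a set of pairs
to its closure. -/
lemma inner_conj_eq_of_mem_closure
    {H : Type*} [NormedAddCommGroup H] [InnerProductSpace ℂ H]
    {J : H → H} (hJ : Continuous J) {S : Set (H × H)}
    (hS : ∀ p ∈ S, ∀ q ∈ S, ⟪p.2, J q.2⟫ = ⟪p.1, J q.1⟫)
    {p q : H × H} (hp : p ∈ closure S) (hq : q ∈ closure S) :
    ⟪p.2, J q.2⟫ = ⟪p.1, J q.1⟫ := by
  have hclosed : IsClosed {r : (H × H) × (H × H) | ⟪r.1.2, J r.2.2⟫ = ⟪r.1.1, J r.2.1⟫} :=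
    isClosed_eq (by fun_prop) (by fun_prop)
  have hmem : (p, q) ∈ closure (S ×ˢ S) := by
    rw [closure_prod_eq]
    exact ⟨hp, hq⟩
  exact closure_minimal (fun r hr ↦ hS r.1 hr.1 r.2 hr.2) hclosed hmem

/-- A `J`-isometric operator `A` with dense domain and dense range in a
complex Hilbert space is closable, and its closure is again `J`-isometric. -/
theorem closable_and_closure_jIsometric
    {H : Type*} [NormedAddCommGroup H] [InnerProductSpace ℂ H] [CompleteSpace H]
    (J : H → H)
    (hJ_add : ∀ x y : H, J (x + y) = J x + J y)
    (hJ_smul : ∀ (c : ℂ) (x : H), J (c • x) = (starRingEnd ℂ c) • J x)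
    (hJ_invol : ∀ x : H, J (J x) = x)
    (hJ_inner : ∀ x y : H, ⟪J x, J y⟫ = ⟪y, x⟫)
    (A : H →ₗ.[ℂ] H) (hA_dense : Dense (A.domain : Set H))
    (hA_range_dense : Dense (LinearMap.range A.toFun : Set H))
    (hA_isom : ∀ x y : A.domain, ⟪A x, J (A y)⟫ = ⟪(x : H), J (y : H)⟫) :
    A.IsClosable ∧
      ∀ x y : A.closure.domain,
        ⟪A.closure x, J (A.closure y)⟫ = ⟪(x : H), J (y : H)⟫ := by
  have hJ := continuous_of_add_of_inner_swap J hJ_add hJ_inner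
  have hgraph : ∀ p ∈ (A.graph : Set (H × H)), ∀ q ∈ (A.graph : Set (H × H)),
      ⟪p.2, J q.2⟫ = ⟪p.1, J q.1⟫ := by
    intro p hp q hq
    obtain ⟨x, hx, hAx⟩ := (LinearPMap.mem_graph_iff A).1 hp
    obtain ⟨y, hy, hAy⟩ := (LinearPMap.mem_graph_iff A).1 hq
    rw [← hx, ← hAx, ← hy, ← hAy, hA_isom]
  have hclosable : A.IsClosable := by
    refine ⟨A.graph.topologicalClosure.toLinearPMap,
      (Submodule.toLinearPMap_graph_eq _ fun p hp hp₁ ↦ ?_).symm⟩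
    have horth : ∀ w, ⟪p.2, J w⟫ = 0 := by
      have hclosed : IsClosed {w | ⟪p.2, J w⟫ = 0} := isClosed_eq (by fun_prop) (by fun_prop)
      intro w
      refine closure_minimal ?_ hclosed (hA_range_dense w)
      rintro _ ⟨y, rfl⟩
      have h := inner_conj_eq_of_mem_closure hJ hgraph hp (subset_closure (A.mem_graph y))
      simpa [hp₁] using h
    have hself := horth (J p.2)
    rwa [hJ_invol, inner_self_eq_zero] at hself
  refine ⟨hclosable, fun x y ↦ ?_⟩
  have hmem : ∀ z : A.closure.domain,
      ((z : H), A.closure z) ∈ closure (A.graph : Set (H × H)) := fun z ↦ by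
    rw [← Submodule.topologicalClosure_coe, hclosable.graph_closure_eq_closure_graph]
    exact A.closure.mem_graph z
  exact inner_conj_eq_of_mem_closure hJ hgraph (hmem x) (hmem y)
end

section
/- Let H be a complex Hilbert space, J a conjugation on H, and A a closed densely defined J-skew-symmetric linear operator in H. Let R be the conjugation on H ⊕ H given by R{x,y} = {Jy, Jx}, G_A the graph of A, and D = (H ⊕ H) ⊖ (G_A ⊕ RG_A) the orthogonal complement of the (orthogonal) sum G_A ⊕ RG_A. Then R maps D onto itself: RD = D. Moreover, if X is a closed subspace of D such that D is the orthogonal direct sum X ⊕ RX, then G_A ⊕ X is the graph of a densely defined linear operator B extending A, and B is J-skew-self-adjoint: JBJ = −B*. -/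
open scoped ComplexInnerProductSpace

/-- The defect subspace `D = (H ⊕ H) ⊖ (G_A ⊕ R G_A)`: the set of `p ∈ H ⊕ H` orthogonal
both to the graph `G_A` of `A` and to `R G_A`, where `R{x,y} = {Jy, Jx}`. -/
def defectSet {H : Type*} [NormedAddCommGroup H] [InnerProductSpace ℂ H] [CompleteSpace H]
    (J : H → H) (A : H →ₗ.[ℂ] H) : Set (H × H) :=
  {p : H × H | (∀ x : A.domain, ⟪p.1, (x : H)⟫ + ⟪p.2, A x⟫ = 0) ∧
    (∀ x : A.domain, ⟪p.1, J (A x)⟫ + ⟪p.2, J (x : H)⟫ = 0)}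

/-- Orthogonal decomposition along a closed subspace of `H × H`, for the Hilbert sum inner
product. -/
theorem exists_mem_sub_orthogonal_of_isClosed_prod {H : Type*} [NormedAddCommGroup H]
    [InnerProductSpace ℂ H] [CompleteSpace H] (G : Submodule ℂ (H × H))
    (hG : IsClosed (G : Set (H × H))) (p : H × H) :
    ∃ a ∈ G, ∀ g ∈ G, ⟪p.1 - a.1, g.1⟫ + ⟪p.2 - a.2, g.2⟫ = 0 := by
  let K : Submodule ℂ (WithLp 2 (H × H)) :=
    G.comap (WithLp.linearEquiv 2 ℂ (H × H)).toLinearMap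
  have hK : IsClosed (K : Set (WithLp 2 (H × H))) :=
    hG.preimage (WithLp.prod_continuous_ofLp 2 H H)
  have : CompleteSpace K := hK.completeSpace_coe
  let x : WithLp 2 (H × H) := WithLp.toLp 2 p
  refine ⟨(K.starProjection x).ofLp, K.starProjection_apply_mem x, fun g hg => ?_⟩
  have h := K.starProjection_inner_eq_zero x (WithLp.toLp 2 g) (show g ∈ G from hg)
  rw [WithLp.prod_inner_apply] at h
  exact h

section Conjugation

variable {H : Type*} [NormedAddCommGroup H] [InnerProductSpace ℂ H] {J : H → H}

theorem conjugation_inner_left (hJ_invol : ∀ x : H, J (J x) = x)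
    (hJ_inner : ∀ x y : H, ⟪J x, J y⟫ = ⟪y, x⟫) (x y : H) : ⟪J x, y⟫ = ⟪J y, x⟫ := by
  rw [← hJ_inner, hJ_invol]

theorem conjugation_inner_right (hJ_invol : ∀ x : H, J (J x) = x)
    (hJ_inner : ∀ x y : H, ⟪J x, J y⟫ = ⟪y, x⟫) (x y : H) : ⟪x, J y⟫ = ⟪y, J x⟫ := by
  rw [← hJ_inner, hJ_invol]

theorem conjugation_neg (hJ_smul : ∀ (c : ℂ) (x : H), J (c • x) = (starRingEnd ℂ c) • J x)
    (x : H) : J (-x) = -J x := by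
  simpa using hJ_smul (-1) x

/-- If the form `⟪p₁, J q₂⟫ + ⟪p₂, J q₁⟫` vanishes on `G`, on `X`, and between `X` and `G`, then it
vanishes on `G ⊔ X`. -/
theorem conjugation_isotropic_sup (hJ_add : ∀ x y : H, J (x + y) = J x + J y)
    (hJ_invol : ∀ x : H, J (J x) = x) (hJ_inner : ∀ x y : H, ⟪J x, J y⟫ = ⟪y, x⟫)
    {G X : Submodule ℂ (H × H)}
    (hG : ∀ p ∈ G, ∀ q ∈ G, ⟪p.1, J q.2⟫ + ⟪p.2, J q.1⟫ = 0)
    (hX : ∀ p ∈ X, ∀ q ∈ X, ⟪p.1, J q.2⟫ + ⟪p.2, J q.1⟫ = 0)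
    (hXG : ∀ p ∈ X, ∀ q ∈ G, ⟪p.1, J q.2⟫ + ⟪p.2, J q.1⟫ = 0) :
    ∀ p ∈ G ⊔ X, ∀ q ∈ G ⊔ X, ⟪p.1, J q.2⟫ + ⟪p.2, J q.1⟫ = 0 := by
  intro p hp q hq
  obtain ⟨a, ha, x, hx, rfl⟩ := Submodule.mem_sup.1 hp
  obtain ⟨b, hb, y, hy, rfl⟩ := Submodule.mem_sup.1 hq
  have h := hXG y hy a ha
  rw [conjugation_inner_right hJ_invol hJ_inner y.1,
    conjugation_inner_right hJ_invol hJ_inner y.2] at h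
  simp only [Prod.fst_add, Prod.snd_add, hJ_add, inner_add_left, inner_add_right]
  linear_combination hG a ha b hb + hX x hx y hy + hXG x hx b hb + h

variable [CompleteSpace H]

theorem mem_defectSet_iff_graph (A : H →ₗ.[ℂ] H) (p : H × H) :
    p ∈ defectSet J A ↔ (∀ g ∈ A.graph, ⟪p.1, g.1⟫ + ⟪p.2, g.2⟫ = 0) ∧
      ∀ g ∈ A.graph, ⟪p.1, J g.2⟫ + ⟪p.2, J g.1⟫ = 0 := by
  refine and_congr ⟨?_, fun h x => h _ (A.mem_graph x)⟩ ⟨?_, fun h x => h _ (A.mem_graph x)⟩ <;>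
  · intro h g hg
    obtain ⟨x, rfl⟩ := (A.mem_graph_iff').1 hg
    exact h x

theorem swap_conjugation_mem_defectSet (hJ_invol : ∀ x : H, J (J x) = x)
    (hJ_inner : ∀ x y : H, ⟪J x, J y⟫ = ⟪y, x⟫) {A : H →ₗ.[ℂ] H} {p : H × H}
    (hp : p ∈ defectSet J A) : (J p.2, J p.1) ∈ defectSet J A := by
  refine ⟨fun x => ?_, fun x => ?_⟩
  · have h := congrArg (starRingEnd ℂ) (hp.2 x)
    rw [map_add, inner_conj_symm, inner_conj_symm, map_zero,
      conjugation_inner_left hJ_invol hJ_inner (A x),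
      conjugation_inner_left hJ_invol hJ_inner (x : H)] at h
    simpa only [add_comm] using h
  · have h := congrArg (starRingEnd ℂ) (hp.1 x)
    rw [map_add, inner_conj_symm, inner_conj_symm, map_zero] at h
    simpa only [hJ_inner, add_comm] using h

/-- The graph of the extension is maximal: its orthogonal complement is contained in its image
under `(x, y) ↦ (J y, J x)`. -/
theorem swap_conjugation_mem_sup_of_orthogonal (hJ_add : ∀ x y : H, J (x + y) = J x + J y)
    (hJ_invol : ∀ x : H, J (J x) = x) (hJ_inner : ∀ x y : H, ⟪J x, J y⟫ = ⟪y, x⟫)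
    {A : H →ₗ.[ℂ] H} (hA_closed : A.IsClosed) {X : Submodule ℂ (H × H)}
    (hiso : ∀ p ∈ A.graph ⊔ X, ∀ q ∈ A.graph ⊔ X, ⟪p.1, J q.2⟫ + ⟪p.2, J q.1⟫ = 0)
    (hspan : ∀ p ∈ defectSet J A, ∃ q ∈ X, ∃ r ∈ X, p = q + (J r.2, J r.1)) {p : H × H}
    (hp : ∀ g ∈ A.graph ⊔ X, ⟪p.1, g.1⟫ + ⟪p.2, g.2⟫ = 0) :
    (J p.2, J p.1) ∈ A.graph ⊔ X := by
  have hiso' : ∀ a ∈ A.graph ⊔ X, ∀ g ∈ A.graph ⊔ X, ⟪J a.2, g.1⟫ + ⟪J a.1, g.2⟫ = 0 := by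
    intro a ha g hg
    have h := congrArg (starRingEnd ℂ) (hiso g hg a ha)
    rwa [map_add, inner_conj_symm, inner_conj_symm, map_zero] at h
  obtain ⟨a, ha, hb⟩ :=
    exists_mem_sub_orthogonal_of_isClosed_prod A.graph hA_closed (J p.2, J p.1)
  have ha' : a ∈ A.graph ⊔ X := Submodule.mem_sup_left ha
  obtain ⟨b, hab⟩ : ∃ b, b = (J p.2, J p.1) - a := ⟨_, rfl⟩
  have hbG : ∀ g ∈ A.graph, ⟪b.1, g.1⟫ + ⟪b.2, g.2⟫ = 0 := by
    rw [hab]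
    exact hb
  have hRp : (J p.2, J p.1) = a + b := by rw [hab, add_sub_cancel]
  have hp1 : p.1 = J a.2 + J b.2 := by
    rw [← hJ_add, ← hJ_invol p.1]
    exact congrArg J (congrArg Prod.snd hRp)
  have hp2 : p.2 = J a.1 + J b.1 := by
    rw [← hJ_add, ← hJ_invol p.2]
    exact congrArg J (congrArg Prod.fst hRp)
  have hortho : ∀ g ∈ A.graph ⊔ X, ⟪J b.2, g.1⟫ + ⟪J b.1, g.2⟫ = 0 := by
    intro g hg
    have h := hp g hg
    rw [hp1, hp2, inner_add_left, inner_add_left] at h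
    linear_combination h - hiso' a ha' g hg
  have hs : (J b.2, J b.1) ∈ defectSet J A := by
    refine (mem_defectSet_iff_graph A _).2
      ⟨fun g hg => hortho g (Submodule.mem_sup_left hg), fun g hg => ?_⟩
    have h := congrArg (starRingEnd ℂ) (hbG g hg)
    rw [map_add, inner_conj_symm, inner_conj_symm, map_zero] at h
    simpa only [hJ_inner, add_comm] using h
  obtain ⟨q, hq, r, hr, hqr⟩ := hspan _ hs
  have h1 : J b.2 = q.1 + J r.2 := congrArg Prod.fst hqr
  have h2 : J b.1 = q.2 + J r.1 := congrArg Prod.snd hqr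
  have hqX : q ∈ A.graph ⊔ X := Submodule.mem_sup_right hq
  have hrX : r ∈ A.graph ⊔ X := Submodule.mem_sup_right hr
  have hqq : ⟪q.1, q.1⟫ + ⟪q.2, q.2⟫ = 0 := by
    have h := hortho q hqX
    rw [h1, h2, inner_add_left, inner_add_left] at h
    linear_combination h - hiso' r hrX q hqX
  have hn : ‖q.1‖ ^ 2 + ‖q.2‖ ^ 2 = 0 := by
    rw [inner_self_eq_norm_sq_to_K, inner_self_eq_norm_sq_to_K] at hqq
    exact Complex.ofReal_injective (by simpa using hqq)
  have hq1 : q.1 = 0 := norm_eq_zero.1 (by nlinarith [sq_nonneg ‖q.1‖, sq_nonneg ‖q.2‖])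
  have hq2 : q.2 = 0 := norm_eq_zero.1 (by nlinarith [sq_nonneg ‖q.1‖, sq_nonneg ‖q.2‖])
  rw [hq1, zero_add] at h1
  rw [hq2, zero_add] at h2
  have hbr : b = r := by
    ext
    · rw [← hJ_invol b.1, h2, hJ_invol]
    · rw [← hJ_invol b.2, h1, hJ_invol]
  rw [hRp, hbr]
  exact add_mem ha' hrX

end Conjugation

/-- Let `A` be a closed densely defined `J`-skew-symmetric operator,
`R{x,y} = {Jy, Jx}`, and `D = (H ⊕ H) ⊖ (G_A ⊕ R G_A)`.  Then `R D = D`; and whenever `X`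
is a closed subspace of `D` with `D = X ⊕ R X` (orthogonal direct sum), the subspace
`G_A ⊕ X` is the graph of a densely defined operator `B` extending `A` which is
`J`-skew-self-adjoint (`J B J = -B*`, i.e. `D(B*) = J(D(B))` and `B* u = -J B J u`). -/
theorem RD_eq_D_and_extension_of_defect_halving
    {H : Type*} [NormedAddCommGroup H] [InnerProductSpace ℂ H] [CompleteSpace H]
    (J : H → H)
    (hJ_add : ∀ x y : H, J (x + y) = J x + J y)
    (hJ_smul : ∀ (c : ℂ) (x : H), J (c • x) = (starRingEnd ℂ c) • J x)
    (hJ_invol : ∀ x : H, J (J x) = x)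
    (hJ_inner : ∀ x y : H, ⟪J x, J y⟫ = ⟪y, x⟫)
    (A : H →ₗ.[ℂ] H) (hA_closed : A.IsClosed) (hA_dense : Dense (A.domain : Set H))
    (hA_skew : ∀ x y : A.domain, ⟪A x, J y⟫ = -⟪(x : H), J (A y)⟫) :
    ((fun p : H × H => (J p.2, J p.1)) '' defectSet J A = defectSet J A) ∧
    ∀ X : Submodule ℂ (H × H), IsClosed (X : Set (H × H)) →
      (X : Set (H × H)) ⊆ defectSet J A →
      (∀ p ∈ X, ∀ q ∈ X, ⟪p.1, J q.2⟫ + ⟪p.2, J q.1⟫ = 0) →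
      (∀ p ∈ defectSet J A, ∃ q ∈ X, ∃ r ∈ X, p = q + (J r.2, J r.1)) →
      ∃ B : H →ₗ.[ℂ] H,
        B.graph = A.graph ⊔ X ∧
        Dense (B.domain : Set H) ∧
        A ≤ B ∧
        (∀ u v : H, (u, v) ∈ B.adjoint.graph ↔
          ∃ h : J u ∈ B.domain, v = -J (B ⟨J u, h⟩)) := by
  refine ⟨Set.Subset.antisymm ?_ ?_, ?_⟩
  · rintro _ ⟨p, hp, rfl⟩
    exact swap_conjugation_mem_defectSet hJ_invol hJ_inner hp
  · intro p hp
    exact ⟨_, swap_conjugation_mem_defectSet hJ_invol hJ_inner hp, by simp [hJ_invol]⟩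
  intro X _ hXD hXX hspan
  have hiso := conjugation_isotropic_sup (G := A.graph) (X := X) hJ_add hJ_invol hJ_inner
    (fun p hp q hq => by
      obtain ⟨x, rfl⟩ := A.mem_graph_iff'.1 hp
      obtain ⟨y, rfl⟩ := A.mem_graph_iff'.1 hq
      simp [hA_skew]) hXX
    (fun p hp => ((mem_defectSet_iff_graph A p).1 (hXD hp)).2)
  have hgraph : (A.graph ⊔ X).toLinearPMap.graph = A.graph ⊔ X := by
    refine Submodule.toLinearPMap_graph_eq _ fun p hp hp1 => ?_
    have h : J p.2 = 0 := by
      refine hA_dense.eq_zero_of_inner_left ℂ fun x hx => ?_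
      have h := hiso p hp _ (Submodule.mem_sup_left (A.mem_graph ⟨x, hx⟩))
      rw [hp1, inner_zero_left, zero_add, ← inner_conj_symm, map_eq_zero,
        conjugation_inner_left hJ_invol hJ_inner] at h
      exact h
    rw [← norm_eq_zero, ← sq_eq_zero_iff]
    have h' := hJ_inner p.2 p.2
    rw [h, inner_zero_left] at h'
    simpa using h'.symm
  set B := (A.graph ⊔ X).toLinearPMap
  have hAB : A ≤ B := LinearPMap.le_of_le_graph (hgraph ▸ le_sup_left)
  have hB_dense : Dense (B.domain : Set H) := hA_dense.mono hAB.1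
  refine ⟨B, hgraph, hB_dense, hAB, fun u v => ?_⟩
  have hmem : (J u, -J v) ∈ A.graph ⊔ X ↔ ∃ h : J u ∈ B.domain, v = -J (B ⟨J u, h⟩) := by
    rw [← hgraph, LinearPMap.mem_graph_iff]
    constructor
    · rintro ⟨y, hy, hBy⟩
      have hy' : J u ∈ B.domain := (show (y : H) = J u from hy) ▸ y.2
      obtain rfl : y = ⟨J u, hy'⟩ := Subtype.ext hy
      refine ⟨hy', ?_⟩
      rw [hBy, conjugation_neg hJ_smul, hJ_invol, neg_neg]
    · rintro ⟨h, hv⟩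
      refine ⟨⟨J u, h⟩, rfl, ?_⟩
      rw [hv, conjugation_neg hJ_smul, hJ_invol, neg_neg]
  rw [← hmem, LinearPMap.adjoint_graph_eq_graph_adjoint hB_dense, hgraph,
    Submodule.mem_adjoint_iff]
  constructor
  · intro h
    have := swap_conjugation_mem_sup_of_orthogonal hJ_add hJ_invol hJ_inner hA_closed hiso hspan
      (p := (-v, u)) fun g hg => by
        have h' := congrArg (starRingEnd ℂ) (h g.1 g.2 hg)
        rw [map_sub, inner_conj_symm, inner_conj_symm, map_zero] at h'
        rw [inner_neg_left]
        linear_combination h'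
    simpa only [conjugation_neg hJ_smul] using this
  · intro h a b hab
    have h' := hiso _ hab _ h
    simp only [conjugation_neg hJ_smul, hJ_invol, inner_neg_right] at h'
    linear_combination h'
end
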